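/- arXiv:2503.05183 — 2 statements merged into one kernel-verified Lean document; each statement's English description precedes it below -/
import Mathlib

section
/- Let L ∈ ℝ^{n1×n2} and let r be an integer with rank(L) ≤ r ≤ min{n1, n2}. There exists ν̄ > 0 such that for every ν with 0 < ν < ν̄ and every function ψ admissible for ν, every Z* ∈ Ω that minimizes ‖Z‖_{F,1}^ψ over Ω satisfies ‖Z*‖_{F,0} = ‖Z*‖_{F,1}^ψ. (Sub-claim at the end of part (i) of the proof of Theorem 3.2, matrix case.) -/
open scoped Matrix

/-- Euclidean norm of the `j`-th column of a real matrix. -/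
noncomputable def colNorm {n r : ℕ} (Z : Matrix (Fin n) (Fin r) ℝ) (j : Fin r) : ℝ :=
  Real.sqrt (∑ i, (Z i j) ^ 2)

/-- Column sparsity `‖Z‖_{F,0}`: the number of nonzero columns of `Z`. -/
noncomputable def colSparsity {n r : ℕ} (Z : Matrix (Fin n) (Fin r) ℝ) : ℕ :=
  {j : Fin r | (fun i => Z i j) ≠ 0}.ncard

/-- Frobenius norm of a real matrix. -/
noncomputable def frobNorm {n r : ℕ} (X : Matrix (Fin n) (Fin r) ℝ) : ℝ :=
  Real.sqrt (∑ i, ∑ j, (X i j) ^ 2)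

/-- `Ω`: matrices `Z` admitting an orthonormal factor `D` with `DᵀD = I` and `L = D Zᵀ`. -/
def Omega {n1 n2 : ℕ} (r : ℕ) (L : Matrix (Fin n1) (Fin n2) ℝ) :
    Set (Matrix (Fin n2) (Fin r) ℝ) :=
  {Z | ∃ D : Matrix (Fin n1) (Fin r) ℝ, Dᵀ * D = 1 ∧ L = D * Zᵀ}

/-- `Q^s`: matrices with at most `s` nonzero columns. -/
def Qset (n r : ℕ) (s : ℕ) : Set (Matrix (Fin n) (Fin r) ℝ) :=
  {Z | colSparsity Z ≤ s}

/-- Frobenius distance from `Z` to the set `Q^s`. -/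
noncomputable def distQ {n r : ℕ} (Z : Matrix (Fin n) (Fin r) ℝ) (s : ℕ) : ℝ :=
  sInf {d : ℝ | ∃ Z' ∈ Qset n r s, d = frobNorm (Z - Z')}

/-- `ψ` is admissible for `ν`: `ψ(0)=0`, `x/ν ≤ ψ(x) < 1` on `(0,ν)`, `ψ(x)=1` on `[ν,∞)`. -/
def Admissible (ν : ℝ) (ψ : ℝ → ℝ) : Prop :=
  ψ 0 = 0 ∧ (∀ x : ℝ, 0 < x → x < ν → x / ν ≤ ψ x ∧ ψ x < 1) ∧ ∀ x : ℝ, ν ≤ x → ψ x = 1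

/-- `‖Z‖_{F,1}^ψ = Σ_j ψ(‖Z(:,j)‖₂)`. -/
noncomputable def psiNorm {n r : ℕ} (ψ : ℝ → ℝ) (Z : Matrix (Fin n) (Fin r) ℝ) : ℝ :=
  ∑ j, ψ (colNorm Z j)

theorem colNorm_nonneg {n r : ℕ} (Z : Matrix (Fin n) (Fin r) ℝ) (j : Fin r) :
    0 ≤ colNorm Z j :=
  Real.sqrt_nonneg _

theorem colNorm_sq {n r : ℕ} (Z : Matrix (Fin n) (Fin r) ℝ) (j : Fin r) :
    colNorm Z j ^ 2 = ∑ i, (Z i j) ^ 2 :=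
  Real.sq_sqrt (Finset.sum_nonneg fun _ _ => sq_nonneg _)

theorem colNorm_eq_zero_iff {n r : ℕ} (Z : Matrix (Fin n) (Fin r) ℝ) (j : Fin r) :
    colNorm Z j = 0 ↔ (fun i => Z i j) = 0 := by
  rw [← sq_eq_zero_iff, colNorm_sq, Finset.sum_eq_zero_iff_of_nonneg fun _ _ => sq_nonneg _]
  simp [funext_iff]

open Classical in
theorem colSparsity_eq_sum {n r : ℕ} (Z : Matrix (Fin n) (Fin r) ℝ) :
    (colSparsity Z : ℝ) = ∑ j, if colNorm Z j = 0 then 0 else 1 := by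
  have h : {j : Fin r | (fun i => Z i j) ≠ 0} =
      (Finset.univ.filter fun j => ¬ colNorm Z j = 0 : Finset (Fin r)) := by
    ext j
    simp [colNorm_eq_zero_iff]
  rw [colSparsity, h, Set.ncard_coe_finset, Finset.card_filter]
  push_cast
  exact Finset.sum_congr rfl fun j _ => by split_ifs <;> simp_all

theorem Admissible.le_one {ν : ℝ} {ψ : ℝ → ℝ} (h : Admissible ν ψ) {x : ℝ} (hx : 0 ≤ x) :
    ψ x ≤ 1 := by
  rcases hx.eq_or_lt with rfl | hx
  · rw [h.1]; exact zero_le_one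
  · rcases lt_or_ge x ν with hν | hν
    · exact (h.2.1 x hx hν).2.le
    · exact (h.2.2 x hν).le

theorem Admissible.div_le {ν : ℝ} {ψ : ℝ → ℝ} (h : Admissible ν ψ) {x : ℝ} (hx : 0 ≤ x)
    (hxν : x < ν) : x / ν ≤ ψ x := by
  rcases hx.eq_or_lt with rfl | hx
  · simp [h.1]
  · exact (h.2.1 x hx hxν).1

theorem psiNorm_le_colSparsity {n r : ℕ} {ν : ℝ} {ψ : ℝ → ℝ} (h : Admissible ν ψ)
    (Z : Matrix (Fin n) (Fin r) ℝ) : psiNorm ψ Z ≤ colSparsity Z := by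
  classical
  rw [colSparsity_eq_sum]
  refine Finset.sum_le_sum fun j _ => ?_
  split_ifs with hj
  · rw [hj, h.1]
  · exact h.le_one (colNorm_nonneg Z j)

/-- The column space of `L` is spanned by the first `L.rank` vectors of an orthonormal basis. -/
theorem exists_orthonormalBasis_dotProduct_col_eq_zero {m n : ℕ} (L : Matrix (Fin m) (Fin n) ℝ) :
    ∃ b : OrthonormalBasis (Fin m) ℝ (EuclideanSpace ℝ (Fin m)),
      ∀ i : Fin m, L.rank ≤ i → ∀ k, ∑ a, b i a * L a k = 0 := by
  let V : Submodule ℝ (EuclideanSpace ℝ (Fin m)) :=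
    Submodule.span ℝ (Set.range fun k => WithLp.toLp 2 (L.col k))
  have hVr : Module.finrank ℝ V = L.rank := by
    rw [Matrix.rank_eq_finrank_span_cols]
    have := LinearEquiv.finrank_map_eq (WithLp.linearEquiv 2 ℝ (Fin m → ℝ)).symm
      (Submodule.span ℝ (Set.range L.col))
    rw [← this, Submodule.map_span, ← Set.range_comp]
    rfl
  let u : OrthonormalBasis (Fin L.rank) ℝ V := (stdOrthonormalBasis ℝ V).reindex (finCongr hVr)
  let v : Fin m → EuclideanSpace ℝ (Fin m) := fun i => if h : i < L.rank then u ⟨i, h⟩ else 0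
  let s : Set (Fin m) := {i | (i : ℕ) < L.rank}
  have hv : Orthonormal ℝ (s.domRestrict v) := by
    have h := (u.orthonormal.comp_linearIsometry V.subtypeₗᵢ).comp
      (fun i : s => (⟨i.1, i.2⟩ : Fin L.rank))
      (fun i j hij => Subtype.ext (Fin.ext (by simpa using hij)))
    convert h using 1
    ext1 i
    have hi : (i.1 : ℕ) < L.rank := i.2
    simp [v, hi, Set.domRestrict]
  obtain ⟨b, hb⟩ := hv.exists_orthonormalBasis_extension_of_card_eq (by simp)
  refine ⟨b, fun i hi k => ?_⟩
  have hmem : WithLp.toLp 2 (L.col k) ∈ V := Submodule.subset_span ⟨k, rfl⟩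
  have hle : L.rank ≤ m := L.rank_le_height
  have horth : ∀ x : V, inner ℝ (b i) (x : EuclideanSpace ℝ (Fin m)) = 0 := by
    intro x
    rw [← u.sum_repr x]
    simp only [Submodule.coe_sum, Submodule.coe_smul, inner_sum, inner_smul_right]
    refine Finset.sum_eq_zero fun j _ => ?_
    have hj : (u j : EuclideanSpace ℝ (Fin m)) = b (Fin.castLE hle j) := by
      rw [hb _ (show ((Fin.castLE hle j : Fin m) : ℕ) < L.rank from j.2)]
      simp [v]
    rw [hj, b.orthonormal.inner_eq_zero, mul_zero]
    rintro rfl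
    exact absurd hi (by simp)
  have := horth ⟨_, hmem⟩
  simpa [PiLp.inner_apply, mul_comm] using this

theorem exists_mem_Omega_colSparsity_le_rank {n1 n2 r : ℕ} (L : Matrix (Fin n1) (Fin n2) ℝ)
    (hr1 : L.rank ≤ r) (hr2 : r ≤ n1) : ∃ Z ∈ Omega r L, colSparsity Z ≤ L.rank := by
  obtain ⟨b, hb⟩ := exists_orthonormalBasis_dotProduct_col_eq_zero L
  let D : Matrix (Fin n1) (Fin r) ℝ := Matrix.of fun a j => b (Fin.castLE hr2 j) a
  refine ⟨(Dᵀ * L)ᵀ, ⟨D, ?_, ?_⟩, ?_⟩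
  · ext i j
    have h := orthonormal_iff_ite.1 b.orthonormal (Fin.castLE hr2 i) (Fin.castLE hr2 j)
    simp only [PiLp.inner_apply, RCLike.inner_apply, conj_trivial, Fin.castLE_inj] at h
    simp only [Matrix.mul_apply, Matrix.transpose_apply, Matrix.one_apply, D, Matrix.of_apply]
    rw [← h]
    exact Finset.sum_congr rfl fun _ _ => mul_comm _ _
  · ext a k
    have h := congrArg (fun x : EuclideanSpace ℝ (Fin n1) => x a)
      (b.sum_repr' (WithLp.toLp 2 (L.col k)))
    simp only [PiLp.inner_apply, RCLike.inner_apply, conj_trivial, WithLp.ofLp_sum,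
      Finset.sum_apply, PiLp.smul_apply, smul_eq_mul, Matrix.col_apply] at h
    rw [← h, Matrix.transpose_transpose, Matrix.mul_apply]
    refine (Fintype.sum_of_injective (Fin.castLE hr2) (Fin.castLE_injective hr2) _ _ ?_ ?_).symm
    · intro i hi
      have hri : r ≤ i := by
        by_contra! hlt
        exact hi ⟨⟨i, hlt⟩, rfl⟩
      have := hb i (hr1.trans hri) k
      simp only [mul_comm (b i _)] at this
      rw [this, zero_mul]
    · intro j
      simp [D, Matrix.mul_apply, mul_comm]
  · have hsub : {j : Fin r | (fun i => (Dᵀ * L)ᵀ i j) ≠ 0} ⊆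
        Set.range (Fin.castLE hr1) := by
      intro j hj
      by_contra hne
      refine hj (funext fun k => ?_)
      have hrj : L.rank ≤ j := by
        by_contra! hlt
        exact hne ⟨⟨j, hlt⟩, rfl⟩
      simpa [D, Matrix.mul_apply] using hb (Fin.castLE hr2 j) (by simpa using hrj) k
    refine (Set.ncard_le_ncard hsub).trans ?_
    rw [Set.ncard_range_of_injective (Fin.castLE_injective hr1)]
    simp

/-- Outside any fewer than `L.rank` columns, the elements of `Omega r L` are bounded away from
zero. -/
theorem exists_pos_le_sum_compl_colNorm {n1 n2 : ℕ} (L : Matrix (Fin n1) (Fin n2) ℝ) :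
    ∃ c : ℝ, 0 < c ∧ ∀ r : ℕ, ∀ Z ∈ Omega r L, ∀ S : Finset (Fin r), S.card < L.rank →
      c ≤ ∑ j ∈ Sᶜ, colNorm Z j := by
  let T := L.toEuclideanLin
  obtain ⟨W, hW⟩ := (LinearMap.ker T).exists_isCompl
  have hWr : Module.finrank ℝ W = L.rank := by
    have h1 := Submodule.finrank_add_eq_of_isCompl hW
    have h2 := T.finrank_range_add_finrank_ker
    rw [L.rank_eq_finrank_range_toLin (EuclideanSpace.basisFun _ ℝ).toBasis
      (EuclideanSpace.basisFun _ ℝ).toBasis, ← Matrix.toEuclideanLin_eq_toLin_orthonormal]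
    change _ = Module.finrank ℝ (LinearMap.range T)
    omega
  have hker : LinearMap.ker (T.domRestrict W) = ⊥ := by
    rw [LinearMap.ker_eq_bot, LinearMap.injective_domRestrict_iff]
    exact hW.disjoint.symm
  obtain ⟨K, hK, hLip⟩ := (T.domRestrict W).exists_antilipschitzWith hker
  have hK' : (0 : ℝ) < K := hK
  refine ⟨(K : ℝ)⁻¹, by positivity, ?_⟩
  rintro r Z ⟨D, hD, hL⟩ S hS
  let f : W →ₗ[ℝ] (S → ℝ) :=
    (LinearMap.funLeft ℝ ℝ (Subtype.val : S → Fin r) ∘ₗ Zᵀ.mulVecLin ∘ₗ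
      (WithLp.linearEquiv 2 ℝ (Fin n2 → ℝ)).toLinearMap) ∘ₗ W.subtype
  have hf : LinearMap.ker f ≠ ⊥ := by
    apply LinearMap.ker_ne_bot_of_finrank_lt
    simpa [hWr] using hS
  obtain ⟨x, hxf, hx0⟩ := Submodule.exists_mem_ne_zero_of_ne_bot hf
  let y : Fin n2 → ℝ := WithLp.ofLp (x : EuclideanSpace ℝ (Fin n2))
  have hxS : ∀ j ∈ S, (Zᵀ *ᵥ y) j = 0 := fun j hj => congrFun (LinearMap.mem_ker.1 hxf) ⟨j, hj⟩
  have hnx : 0 < ‖x‖ := norm_pos_iff.2 hx0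
  have hle : ‖x‖ ≤ K * ‖T x‖ := by
    simpa using hLip.le_mul_dist x 0
  have hTx : ‖T x‖ ^ 2 = ∑ j, (Zᵀ *ᵥ y) j ^ 2 := by
    have h1 : ‖T x‖ ^ 2 = (L *ᵥ y) ⬝ᵥ (L *ᵥ y) := by
      rw [EuclideanSpace.real_norm_sq_eq]
      simp only [dotProduct, ← sq]
      rfl
    rw [h1, hL, ← Matrix.mulVec_mulVec, Matrix.dotProduct_mulVec, Matrix.vecMul_mulVec,
      hD, Matrix.vecMul_one]
    simp [dotProduct, sq]
  have hterm : ∀ j, (Zᵀ *ᵥ y) j ^ 2 ≤ colNorm Z j ^ 2 * ‖x‖ ^ 2 := by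
    intro j
    have h2 : ‖x‖ ^ 2 = ∑ i, y i ^ 2 := EuclideanSpace.real_norm_sq_eq _
    rw [colNorm_sq, h2]
    exact Finset.sum_mul_sq_le_sq_mul_sq Finset.univ (fun i => Z i j) y
  have hnn : 0 ≤ ∑ j ∈ Sᶜ, colNorm Z j := Finset.sum_nonneg fun j _ => colNorm_nonneg Z j
  have hbound : ‖T x‖ ^ 2 ≤ ((∑ j ∈ Sᶜ, colNorm Z j) * ‖x‖) ^ 2 := by
    rw [hTx, ← Finset.sum_add_sum_compl S, Finset.sum_eq_zero, zero_add, mul_pow]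
    · calc _ ≤ ∑ j ∈ Sᶜ, colNorm Z j ^ 2 * ‖x‖ ^ 2 := Finset.sum_le_sum fun j _ => hterm j
        _ = (∑ j ∈ Sᶜ, colNorm Z j ^ 2) * ‖x‖ ^ 2 := (Finset.sum_mul ..).symm
        _ ≤ _ := by
          gcongr
          exact Finset.sum_sq_le_sq_sum_of_nonneg fun j _ => colNorm_nonneg Z j
    · intro j hj
      rw [hxS j hj]; simp
  have hTle := (sq_le_sq₀ (norm_nonneg _) (by positivity)).1 hbound
  rw [inv_le_iff_one_le_mul₀' hK']
  refine le_of_mul_le_mul_right ?_ hnx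
  calc 1 * ‖x‖ ≤ K * ‖T x‖ := by rwa [one_mul]
    _ ≤ K * ((∑ j ∈ Sᶜ, colNorm Z j) * ‖x‖) := by gcongr
    _ = _ := by ring

/-- Sub-claim at the end of part (i) of the proof of Theorem 3.2, matrix case: there is
`ν̄ > 0` such that for every `0 < ν < ν̄` and every `ψ` admissible for `ν`, every global
minimizer `Z*` of `‖·‖_{F,1}^ψ` over `Ω` satisfies `‖Z*‖_{F,0} = ‖Z*‖_{F,1}^ψ`. -/
theorem psiNorm_minimizer_sparsity_eq {n1 n2 r : ℕ}
    (L : Matrix (Fin n1) (Fin n2) ℝ) (hr1 : L.rank ≤ r) (hr2 : r ≤ min n1 n2) :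
    ∃ νbar : ℝ, 0 < νbar ∧ ∀ ν : ℝ, 0 < ν → ν < νbar → ∀ ψ : ℝ → ℝ, Admissible ν ψ →
      ∀ Zstar ∈ Omega r L, (∀ Z ∈ Omega r L, psiNorm ψ Zstar ≤ psiNorm ψ Z) →
        (colSparsity Zstar : ℝ) = psiNorm ψ Zstar := by
  classical
  obtain ⟨c, hc, hsum⟩ := exists_pos_le_sum_compl_colNorm L
  obtain ⟨Z₀, hZ₀, hZ₀s⟩ :=
    exists_mem_Omega_colSparsity_le_rank L hr1 (hr2.trans (min_le_left _ _))
  refine ⟨c / (L.rank + 1), by positivity, fun ν hν hνlt ψ hψ Z hZ hmin => ?_⟩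
  have hle : psiNorm ψ Z ≤ L.rank :=
    (hmin Z₀ hZ₀).trans ((psiNorm_le_colSparsity hψ Z₀).trans (by exact_mod_cast hZ₀s))
  let S : Finset (Fin r) := Finset.univ.filter fun j => ν ≤ colNorm Z j
  have hS : ∑ j ∈ S, ψ (colNorm Z j) = S.card := by
    rw [Finset.sum_congr rfl fun j hj => hψ.2.2 _ (Finset.mem_filter.1 hj).2]
    simp [S]
  have hSc : (∑ j ∈ Sᶜ, colNorm Z j) / ν ≤ ∑ j ∈ Sᶜ, ψ (colNorm Z j) := by
    rw [Finset.sum_div]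
    refine Finset.sum_le_sum fun j hj => hψ.div_le (colNorm_nonneg Z j) ?_
    simpa [S] using hj
  have hsplit : psiNorm ψ Z = S.card + ∑ j ∈ Sᶜ, ψ (colNorm Z j) := by
    rw [psiNorm, ← Finset.sum_add_sum_compl S, hS]
  have hcard : L.rank ≤ S.card := by
    by_contra! hlt
    have h1 := hsum r Z hZ S hlt
    have h2 : (L.rank + 1 : ℝ) < c / ν := by
      rw [lt_div_iff₀ (by positivity)] at hνlt
      rwa [lt_div_iff₀ hν, mul_comm]
    have h3 : c / ν ≤ (∑ j ∈ Sᶜ, colNorm Z j) / ν := by gcongr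
    have h4 : (0 : ℝ) ≤ S.card := Nat.cast_nonneg _
    linarith
  have hcard' : (L.rank : ℝ) ≤ S.card := by exact_mod_cast hcard
  have hzero : ∑ j ∈ Sᶜ, colNorm Z j = 0 := by
    refine le_antisymm ?_ (Finset.sum_nonneg fun j _ => colNorm_nonneg Z j)
    have : (∑ j ∈ Sᶜ, colNorm Z j) / ν ≤ 0 := by linarith
    simpa using (div_le_iff₀ hν).1 this
  rw [colSparsity_eq_sum, psiNorm]
  refine Finset.sum_congr rfl fun j _ => ?_
  split_ifs with hj
  · rw [hj, hψ.1]
  · refine (hψ.2.2 _ ?_).symm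
    by_contra hjν
    exact hj ((Finset.sum_eq_zero_iff_of_nonneg fun j _ => colNorm_nonneg Z j).1 hzero j
      (by simpa [S] using hjν))
end

section
/- Let L ∈ ℝ^{n1×n2} and let r be an integer such that Ω is nonempty, and set N := min{ ‖Z‖_{F,0} : Z ∈ Ω }. Then for every integer s with 0 ≤ s < N, one has dist(Ω, Q^s) := inf{ dist(Z, Q^s) : Z ∈ Ω } > 0. (Positivity of the distances defining ν̄ in the proof of Theorem 3.2, matrix case.) -/
open scoped Matrix

/-- Matrices with orthonormal columns form a compact set. -/
theorem isCompact_setOf_transpose_mul_self_eq_one (m r : ℕ) :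
    IsCompact {D : Matrix (Fin m) (Fin r) ℝ | Dᵀ * D = 1} := by
  have hbox : IsCompact (X := Matrix (Fin m) (Fin r) ℝ)
      (Set.univ.pi fun _ => Set.univ.pi fun _ => Set.Icc (-1) 1) :=
    isCompact_univ_pi fun _ => isCompact_univ_pi fun _ => isCompact_Icc
  refine hbox.of_isClosed_subset (isClosed_eq (by fun_prop) continuous_const) ?_
  intro D (hD : Dᵀ * D = 1) i _ j _
  have hcol : ∑ k, D k j ^ 2 = 1 := by
    have h := congrFun (congrFun hD j) j
    simpa [Matrix.mul_apply, sq] using h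
  have hle : D i j ^ 2 ≤ 1 :=
    hcol ▸ Finset.single_le_sum (f := fun k => D k j ^ 2) (fun _ _ => sq_nonneg _)
      (Finset.mem_univ i)
  exact abs_le.mp ((sq_le_one_iff_abs_le_one _).mp hle)

theorem isCompact_Omega {n1 n2 : ℕ} (r : ℕ) (L : Matrix (Fin n1) (Fin n2) ℝ) :
    IsCompact (Omega r L) := by
  have himage : Omega r L =
      (fun D => Lᵀ * D) '' ({D : Matrix (Fin n1) (Fin r) ℝ | Dᵀ * D = 1} ∩
        {D | L = D * (Lᵀ * D)ᵀ}) := by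
    ext Z
    constructor
    · rintro ⟨D, hD, hL⟩
      have hZ : Lᵀ * D = Z := by
        rw [hL, Matrix.transpose_mul, Matrix.transpose_transpose, Matrix.mul_assoc, hD,
          Matrix.mul_one]
      refine ⟨D, ⟨hD, ?_⟩, hZ⟩
      rw [Set.mem_ofPred_eq, hZ]
      exact hL
    · rintro ⟨D, ⟨hD, hL⟩, rfl⟩
      exact ⟨D, hD, hL⟩
  rw [himage]
  exact ((isCompact_setOf_transpose_mul_self_eq_one n1 r).inter_right
    (isClosed_eq continuous_const (by fun_prop))).image (by fun_prop)

theorem Qset_eq_iUnion (n r s : ℕ) :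
    Qset n r s = ⋃ S : {S : Set (Fin r) // S.ncard ≤ s},
      {Z | ∀ j ∉ S.1, (fun i => Z i j) = 0} := by
  ext Z
  simp only [Set.mem_iUnion]
  constructor
  · intro hZ
    exact ⟨⟨{j | (fun i => Z i j) ≠ 0}, hZ⟩, fun j hj => not_not.mp hj⟩
  · rintro ⟨⟨S, hS⟩, hZ⟩
    refine (Set.ncard_le_ncard (fun j hj => ?_) S.toFinite).trans hS
    by_contra hjS
    exact hj (hZ j hjS)

theorem isClosed_Qset (n r s : ℕ) : IsClosed (Qset n r s) := by
  rw [Qset_eq_iUnion]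
  refine isClosed_iUnion_of_finite fun S => ?_
  simp only [Set.ofPred_forall]
  exact isClosed_iInter fun j => isClosed_iInter fun _ =>
    isClosed_eq (by fun_prop) continuous_const

theorem zero_mem_Qset (n r s : ℕ) : (0 : Matrix (Fin n) (Fin r) ℝ) ∈ Qset n r s := by
  have h : {j : Fin r | (fun i => (0 : Matrix (Fin n) (Fin r) ℝ) i j) ≠ 0} = ∅ :=
    Set.eq_empty_of_forall_notMem fun j hj => hj rfl
  simp only [Qset, colSparsity, Set.mem_ofPred_eq, h, Set.ncard_empty, Nat.zero_le]

section FrobeniusNorm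

attribute [local instance] Matrix.frobeniusNormedAddCommGroup

theorem norm_eq_frobNorm {n r : ℕ} (X : Matrix (Fin n) (Fin r) ℝ) : ‖X‖ = frobNorm X := by
  simp [Matrix.frobenius_norm_def, frobNorm, Real.sqrt_eq_rpow]

/-- A compact set and a disjoint closed set of matrices are a positive Frobenius distance apart. -/
theorem exists_pos_forall_le_frobNorm_sub {n r : ℕ} {A B : Set (Matrix (Fin n) (Fin r) ℝ)}
    (hA : IsCompact A) (hB : IsClosed B) (hAB : Disjoint A B) :
    ∃ δ : ℝ, 0 < δ ∧ ∀ Z ∈ A, ∀ Z' ∈ B, δ ≤ frobNorm (Z - Z') := by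
  obtain ⟨δ, hδ, h⟩ := Metric.exists_pos_forall_lt_edist hA hB hAB
  refine ⟨δ, hδ, fun Z hZ Z' hZ' => ?_⟩
  have hlt := h Z hZ Z' hZ'
  rw [edist_nndist, ENNReal.coe_lt_coe, ← NNReal.coe_lt_coe, coe_nndist, dist_eq_norm,
    norm_eq_frobNorm] at hlt
  exact hlt.le

end FrobeniusNorm

/-- Positivity of the distances defining `ν̄` in the proof of Theorem 3.2, matrix case:
if `Ω` is nonempty and `N = min{‖Z‖_{F,0} : Z ∈ Ω}`, then for every `0 ≤ s < N`,
`dist(Ω, Q^s) = inf{dist(Z, Q^s) : Z ∈ Ω} > 0`. -/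
theorem dist_omega_Qset_pos {n1 n2 r : ℕ} (L : Matrix (Fin n1) (Fin n2) ℝ)
    (hΩ : (Omega r L).Nonempty)
    (N : ℕ) (hN : IsLeast {k : ℕ | ∃ Z ∈ Omega r L, k = colSparsity Z} N) :
    ∀ s : ℕ, s < N → 0 < sInf {d : ℝ | ∃ Z ∈ Omega r L, d = distQ Z s} := by
  intro s hs
  have hdisj : Disjoint (Omega r L) (Qset n2 r s) :=
    Set.disjoint_left.mpr fun Z hZ hQ =>
      absurd ((hN.2 ⟨Z, hZ, rfl⟩).trans hQ) (not_le.mpr hs)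
  obtain ⟨δ, hδ, h⟩ :=
    exists_pos_forall_le_frobNorm_sub (isCompact_Omega r L) (isClosed_Qset n2 r s) hdisj
  refine hδ.trans_le (le_csInf ?_ ?_)
  · obtain ⟨Z, hZ⟩ := hΩ
    exact ⟨_, Z, hZ, rfl⟩
  · rintro _ ⟨Z, hZ, rfl⟩
    refine le_csInf ⟨_, 0, zero_mem_Qset n2 r s, rfl⟩ ?_
    rintro _ ⟨Z', hZ', rfl⟩
    exact h Z hZ Z' hZ'
end
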